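/- arXiv:0910.1850 — 2 statements merged into one kernel-verified Lean document; each statement's English description precedes it below -/
import Mathlib

section
/- Let 3/4 < s ≤ 1. Then for all u ∈ H^s(ℝ³) and v ∈ H^{s−1}(ℝ³), the product uv lies in the homogeneous Sobolev space Ḣ^{-1}(ℝ³), with ‖uv‖_{Ḣ^{-1}} ≤ C ‖u‖_{H^s} ‖v‖_{H^{s−1}}. -/
open MeasureTheory
open scoped ENNReal

lemma aux_ptwise {α β r y : ℝ} (hα : 0 < α) (hβ : 0 < β) (hr : 1 ≤ r) (hy : 1 ≤ y) :
    r ^ (-(2 * α)) * y ^ (-β) ≤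
      2 ^ α * ((1 + r ^ 2) ^ (-(α + β)) + y ^ (-(α + β))) := by
  have h1 : r ^ (-(2 * α)) ≤ 2 ^ α * (1 + r ^ 2) ^ (-α) := by
    have e : r ^ (-(2 * α)) = (r ^ 2) ^ (-α) := by
      rw [← Real.rpow_natCast, ← Real.rpow_mul (by linarith)]; congr 1; push_cast; ring
    have e2 : (2 : ℝ) ^ α * (1 + r ^ 2) ^ (-α) = ((1 + r ^ 2) / 2) ^ (-α) := by
      rw [Real.div_rpow (by positivity) (by norm_num), Real.rpow_neg (by norm_num : (0:ℝ) ≤ 2) α]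
      field_simp
    rw [e, e2]
    apply Real.rpow_le_rpow_of_nonpos (by positivity) (by nlinarith) (by linarith)
  have h2 : (1 + r ^ 2) ^ (-α) * y ^ (-β) ≤ (1 + r ^ 2) ^ (-(α + β)) + y ^ (-(α + β)) := by
    have hp : 0 < 1 + r ^ 2 := by positivity
    have hyp : 0 < y := by linarith
    rcases le_total (1 + r ^ 2) y with h | h
    · have : y ^ (-β) ≤ (1 + r ^ 2) ^ (-β) :=
        Real.rpow_le_rpow_of_nonpos hp h (by linarith)
      calc _ ≤ (1 + r ^ 2) ^ (-α) * (1 + r ^ 2) ^ (-β) := by gcongr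
        _ = (1 + r ^ 2) ^ (-(α + β)) := by rw [← Real.rpow_add hp]; congr 1; ring
        _ ≤ _ := by have : 0 < y ^ (-(α + β)) := by positivity
                    linarith
    · have : (1 + r ^ 2) ^ (-α) ≤ y ^ (-α) :=
        Real.rpow_le_rpow_of_nonpos hyp h (by linarith)
      calc _ ≤ y ^ (-α) * y ^ (-β) := by gcongr
        _ = y ^ (-(α + β)) := by rw [← Real.rpow_add hyp]; congr 1; ring
        _ ≤ _ := by have : 0 < (1 + r ^ 2) ^ (-(α + β)) := by positivity
                    linarith
  calc _ ≤ 2 ^ α * (1 + r ^ 2) ^ (-α) * y ^ (-β) := by gcongr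
    _ = 2 ^ α * ((1 + r ^ 2) ^ (-α) * y ^ (-β)) := by ring
    _ ≤ _ := by gcongr

lemma aux_kernel {α β : ℝ} (hα : 0 < α) (hβ : 0 < β) (hα3 : 2 * α < 3) (hab : 3 < 2 * (α + β)) :
    ∃ D : ℝ≥0∞, D ≠ ∞ ∧ ∀ ζ : EuclideanSpace ℝ (Fin 3),
      ∫⁻ ξ : EuclideanSpace ℝ (Fin 3), ENNReal.ofReal (‖ξ‖ ^ (-(2 * α)) * (1 + ‖ξ - ζ‖ ^ 2) ^ (-β)) ≤ D := by
  set J : ℝ≥0∞ := ∫⁻ ξ : EuclideanSpace ℝ (Fin 3), ENNReal.ofReal ((1 + ‖ξ‖ ^ 2) ^ (-(α + β))) with hJ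
  set B : ℝ≥0∞ := ∫⁻ ξ in Metric.ball (0 : EuclideanSpace ℝ (Fin 3)) 1, ENNReal.ofReal (‖ξ‖ ^ (-(2 * α))) with hB
  have hJf : J ≠ ∞ := by
    have := (integrable_rpow_neg_one_add_norm_sq (E := EuclideanSpace ℝ (Fin 3)) (μ := volume) (r := 2 * (α + β))
      (by simpa using hab)).lintegral_lt_top
    convert this.ne using 6
    ring
  have hBf : B ≠ ∞ := by
    have : IntegrableOn (fun ξ : EuclideanSpace ℝ (Fin 3) => ‖ξ‖ ^ (-(2 * α))) (Metric.ball 0 1) volume := by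
      refine integrableOn_ball_of_norm_le_rpow (C := 1) (α := 2 * α) ?_ ?_ ?_ ?_
      · simp
      · simpa using hα3
      · filter_upwards with x
        rw [Real.norm_of_nonneg (by positivity), one_mul]
      · exact Measurable.aestronglyMeasurable (by fun_prop)
    exact this.lintegral_lt_top.ne
  refine ⟨B + ENNReal.ofReal (2 ^ α) * (J + J), by finiteness, fun ζ => ?_⟩
  calc _ ≤ ∫⁻ ξ : EuclideanSpace ℝ (Fin 3), ((Metric.ball (0 : EuclideanSpace ℝ (Fin 3)) 1).indicator
          (fun ξ => ENNReal.ofReal (‖ξ‖ ^ (-(2 * α)))) ξ + ENNReal.ofReal (2 ^ α) *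
          (ENNReal.ofReal ((1 + ‖ξ‖ ^ 2) ^ (-(α + β))) +
            ENNReal.ofReal ((1 + ‖ξ - ζ‖ ^ 2) ^ (-(α + β))))) := by
        apply lintegral_mono
        intro ξ
        dsimp only
        by_cases h : ξ ∈ Metric.ball (0 : EuclideanSpace ℝ (Fin 3)) 1
        · rw [Set.indicator_of_mem h]
          refine le_trans (ENNReal.ofReal_le_ofReal ?_) le_self_add
          apply mul_le_of_le_one_right (by positivity)
          apply Real.rpow_le_one_of_one_le_of_nonpos _ (by linarith)
          nlinarith [sq_nonneg ‖ξ - ζ‖]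
        · rw [Set.indicator_of_notMem h, zero_add, ← ENNReal.ofReal_add (by positivity) (by positivity),
            ← ENNReal.ofReal_mul (by positivity)]
          apply ENNReal.ofReal_le_ofReal
          apply aux_ptwise hα hβ
          · simpa using h
          · nlinarith [sq_nonneg ‖ξ - ζ‖]
    _ = _ := by
        rw [lintegral_add_left (Measurable.indicator (by fun_prop) measurableSet_ball),
          lintegral_indicator measurableSet_ball, lintegral_const_mul _ (by fun_prop),
          lintegral_add_left (by fun_prop)]
        rw [lintegral_sub_right_eq_self (fun ξ : EuclideanSpace ℝ (Fin 3) => ENNReal.ofReal ((1 + ‖ξ‖ ^ 2) ^ (-(α + β)))) ζ]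

lemma aux_K (s : ℝ) (hs0 : 3 / 4 < s) (hs1 : s ≤ 1) :
    ∃ D : ℝ≥0∞, D ≠ ∞ ∧ ∀ ζ : EuclideanSpace ℝ (Fin 3),
      ∫⁻ ξ : EuclideanSpace ℝ (Fin 3), ENNReal.ofReal (‖ξ‖ ^ (-2 : ℝ)) * ENNReal.ofReal ((1 + ‖ξ - ζ‖ ^ 2) ^ (-s)) ≤
        D * ENNReal.ofReal ((1 + ‖ζ‖ ^ 2) ^ (s - 1)) := by
  obtain ⟨D1, hD1, h1⟩ := aux_kernel (α := s) (β := s) (by linarith) (by linarith) (by linarith)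
    (by linarith)
  obtain ⟨D2, hD2, h2⟩ := aux_kernel (α := 1) (β := 2 * s - 1) (by linarith) (by linarith)
    (by linarith) (by linarith)
  refine ⟨ENNReal.ofReal (2 ^ (1 - s)) * (D1 + D2), by finiteness, fun ζ => ?_⟩
  calc _ ≤ ∫⁻ ξ : EuclideanSpace ℝ (Fin 3), ENNReal.ofReal ((1 + ‖ζ‖ ^ 2) ^ (s - 1)) * (ENNReal.ofReal (2 ^ (1 - s)) *
        (ENNReal.ofReal (‖ξ‖ ^ (-(2 * s)) * (1 + ‖ξ - ζ‖ ^ 2) ^ (-s)) +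
         ENNReal.ofReal (‖ξ‖ ^ (-(2 * 1) : ℝ) * (1 + ‖ξ - ζ‖ ^ 2) ^ (-(2 * s - 1))))) := by
        apply lintegral_mono_ae
        have : ∀ᵐ ξ : EuclideanSpace ℝ (Fin 3), ξ ≠ 0 := by
          simp [ae_iff]
        filter_upwards [this] with ξ hξ
        rw [← ENNReal.ofReal_add (by positivity) (by positivity),
          ← ENNReal.ofReal_mul (by positivity), ← ENNReal.ofReal_mul (by positivity),
          ← ENNReal.ofReal_mul (by positivity)]
        apply ENNReal.ofReal_le_ofReal
        have hr : 0 < ‖ξ‖ := norm_pos_iff.mpr hξ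
        set r := ‖ξ‖
        set Y := 1 + ‖ξ - ζ‖ ^ 2 with hY
        have hYp : 0 < Y := by positivity
        set Z := 1 + ‖ζ‖ ^ 2 with hZ
        have hZp : 0 < Z := by positivity
        have hZle : Z ≤ 2 * (r ^ 2 + Y) := by
          have : ‖ζ‖ ≤ r + ‖ξ - ζ‖ := by
            have := norm_sub_le ξ (ξ - ζ)
            simpa using this
          have h3 := norm_nonneg ζ
          nlinarith [sq_nonneg (r - ‖ξ - ζ‖)]
        have key : Z ^ (1 - s) ≤ 2 ^ (1 - s) * (r ^ (2 - 2 * s) + Y ^ (1 - s)) := by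
          calc _ ≤ (2 * (r ^ 2 + Y)) ^ (1 - s) :=
                Real.rpow_le_rpow hZp.le hZle (by linarith)
            _ = 2 ^ (1 - s) * (r ^ 2 + Y) ^ (1 - s) :=
                Real.mul_rpow (by norm_num) (by positivity)
            _ ≤ 2 ^ (1 - s) * ((r ^ 2) ^ (1 - s) + Y ^ (1 - s)) := by
                gcongr
                exact Real.rpow_add_le_add_rpow (by positivity) hYp.le (by linarith) (by linarith)
            _ = _ := by
                rw [← Real.rpow_natCast r 2, ← Real.rpow_mul hr.le]
                congr 3; push_cast; ring
        have hz1 : Z ^ (s - 1) * Z ^ (1 - s) = 1 := by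
          rw [← Real.rpow_add hZp]; simp
        have e1 : r ^ (-(2 * s)) = r ^ (-2 : ℝ) * r ^ (2 - 2 * s) := by
          rw [← Real.rpow_add hr]; congr 1; ring
        have e2 : Y ^ (-(2 * s - 1)) = Y ^ (-s) * Y ^ (1 - s) := by
          rw [← Real.rpow_add hYp]; congr 1; ring
        have e3 : (-(2 * 1) : ℝ) = -2 := by norm_num
        rw [e1, e2, e3]
        calc r ^ (-2 : ℝ) * Y ^ (-s) = Z ^ (s - 1) * Z ^ (1 - s) * (r ^ (-2 : ℝ) * Y ^ (-s)) := by
              rw [hz1, one_mul]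
          _ ≤ Z ^ (s - 1) * (2 ^ (1 - s) * (r ^ (2 - 2 * s) + Y ^ (1 - s))) *
                (r ^ (-2 : ℝ) * Y ^ (-s)) := by gcongr
          _ = _ := by ring
    _ = ENNReal.ofReal ((1 + ‖ζ‖ ^ 2) ^ (s - 1)) * (ENNReal.ofReal (2 ^ (1 - s)) *
        ((∫⁻ ξ : EuclideanSpace ℝ (Fin 3), ENNReal.ofReal (‖ξ‖ ^ (-(2 * s)) * (1 + ‖ξ - ζ‖ ^ 2) ^ (-s))) +
         ∫⁻ ξ : EuclideanSpace ℝ (Fin 3), ENNReal.ofReal (‖ξ‖ ^ (-(2 * 1) : ℝ) *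
          (1 + ‖ξ - ζ‖ ^ 2) ^ (-(2 * s - 1))))) := by
        rw [lintegral_const_mul _ (by fun_prop), lintegral_const_mul _ (by fun_prop),
          lintegral_add_left (by fun_prop)]
    _ ≤ ENNReal.ofReal ((1 + ‖ζ‖ ^ 2) ^ (s - 1)) * (ENNReal.ofReal (2 ^ (1 - s)) * (D1 + D2)) := by
        gcongr
        · exact h1 ζ
        · exact h2 ζ
    _ = _ := by ring

lemma aux_CS {X : Type*} [MeasurableSpace X] (μ : Measure X) {f g : X → ℝ≥0∞}
    (hf : Measurable f) (hg : Measurable g) :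
    (∫⁻ a, f a * g a ∂μ) ^ 2 ≤ (∫⁻ a, f a ^ 2 ∂μ) * ∫⁻ a, g a ^ 2 ∂μ := by
  have h := ENNReal.lintegral_mul_le_Lp_mul_Lq μ Real.HolderConjugate.two_two
    hf.aemeasurable hg.aemeasurable
  simp only [Pi.mul_apply, ENNReal.rpow_two] at h
  calc _ ≤ ((∫⁻ a, f a ^ 2 ∂μ) ^ (1 / 2 : ℝ) * (∫⁻ a, g a ^ 2 ∂μ) ^ (1 / 2 : ℝ)) ^ 2 := by gcongr
    _ = _ := by
      rw [mul_pow, ← ENNReal.rpow_two, ← ENNReal.rpow_two, ← ENNReal.rpow_mul, ← ENNReal.rpow_mul]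
      norm_num

lemma aux_dual {X : Type*} [MeasurableSpace X] (μ : Measure X) [SigmaFinite μ] {G : X → ℝ≥0∞}
    (hG : Measurable G) (M : ℝ≥0∞)
    (H : ∀ h : X → ℝ≥0∞, Measurable h → (∫⁻ a, h a * G a ∂μ) ^ 2 ≤ M * ∫⁻ a, h a ^ 2 ∂μ) :
    ∫⁻ a, G a ^ 2 ∂μ ≤ M := by
  set h : ℕ → X → ℝ≥0∞ := fun n => (spanningSets μ n).indicator (fun x => min (G x) n) with hh
  have hm : ∀ n, Measurable (h n) := fun n =>
    (hG.min measurable_const).indicator (measurableSet_spanningSets μ n)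
  have hle : ∀ n x, h n x ≤ G x := fun n x => by
    simp only [hh]
    exact (Set.indicator_le_self' (by simp) x).trans (min_le_left _ _)
  have hbd : ∀ n, ∫⁻ a, h n a ^ 2 ∂μ ≤ M := fun n => by
    set T := ∫⁻ a, h n a ^ 2 ∂μ with hT
    have hfin : T ≠ ∞ := by
      have : T ≤ ∫⁻ a, (spanningSets μ n).indicator (fun _ => (n : ℝ≥0∞) ^ 2) a ∂μ := by
        apply lintegral_mono
        intro a
        by_cases ha : a ∈ spanningSets μ n
        · simp only [hh, Set.indicator_of_mem ha]
          gcongr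
          exact min_le_right _ _
        · simp [hh, Set.indicator_of_notMem ha]
      rw [lintegral_indicator_const (measurableSet_spanningSets μ n)] at this
      refine ne_top_of_le_ne_top ?_ this
      have := (measure_spanningSets_lt_top μ n).ne
      finiteness
    have h1 : T ≤ ∫⁻ a, h n a * G a ∂μ := by
      apply lintegral_mono
      intro a
      dsimp only
      rw [sq]
      gcongr
      exact hle n a
    have h2 : T * T ≤ M * T := by
      rw [← sq]
      exact (by gcongr : T ^ 2 ≤ _).trans (H (h n) (hm n))
    by_cases h0 : T = 0
    · simp [h0]
    · exact (ENNReal.mul_le_mul_iff_left h0 hfin).mp h2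
  have ht : Filter.Tendsto (fun n => ∫⁻ a, h n a ^ 2 ∂μ) Filter.atTop
      (nhds (∫⁻ a, G a ^ 2 ∂μ)) := by
    apply lintegral_tendsto_of_tendsto_of_monotone
    · exact fun n => ((hm n).pow_const 2).aemeasurable
    · filter_upwards with x m n hmn
      dsimp only
      gcongr
      simp only [hh]
      by_cases hx : x ∈ spanningSets μ m
      · rw [Set.indicator_of_mem hx, Set.indicator_of_mem (monotone_spanningSets μ hmn hx)]
        gcongr
      · rw [Set.indicator_of_notMem hx]; exact zero_le
    · filter_upwards with x
      apply ENNReal.Tendsto.pow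
      have h1 : Filter.Tendsto (fun n : ℕ => min (G x) (n : ℝ≥0∞)) Filter.atTop
          (nhds (min (G x) ∞)) := tendsto_const_nhds.min ENNReal.tendsto_nat_nhds_top
      rw [min_top_right] at h1
      refine h1.congr' ?_
      filter_upwards [Filter.eventually_ge_atTop (spanningSetsIndex μ x)] with n hn
      simp only [hh]
      rw [Set.indicator_of_mem]
      exact monotone_spanningSets μ hn (mem_spanningSetsIndex μ x)
  exact le_of_tendsto' ht hbd

lemma aux_main (s : ℝ) {D : ℝ≥0∞}
    (hD : ∀ ζ : EuclideanSpace ℝ (Fin 3),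
      ∫⁻ ξ : EuclideanSpace ℝ (Fin 3), ENNReal.ofReal (‖ξ‖ ^ (-2 : ℝ)) * ENNReal.ofReal ((1 + ‖ξ - ζ‖ ^ 2) ^ (-s)) ≤
        D * ENNReal.ofReal ((1 + ‖ζ‖ ^ 2) ^ (s - 1)))
    {U V : EuclideanSpace ℝ (Fin 3) → ℝ≥0∞} (hU : Measurable U) (hV : Measurable V) :
    ∫⁻ ξ : EuclideanSpace ℝ (Fin 3), (ENNReal.ofReal (‖ξ‖ ^ (-1 : ℝ)) * ∫⁻ η, U η * V (ξ - η)) ^ 2 ≤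
      D * (∫⁻ ξ, ENNReal.ofReal ((1 + ‖ξ‖ ^ 2) ^ s) * U ξ ^ 2) *
        ∫⁻ ξ, ENNReal.ofReal ((1 + ‖ξ‖ ^ 2) ^ (s - 1)) * V ξ ^ 2 := by
  have hUV : Measurable (fun p : EuclideanSpace ℝ (Fin 3) × EuclideanSpace ℝ (Fin 3) => U p.2 * V (p.1 - p.2)) := by fun_prop
  have hF : Measurable (fun ξ : EuclideanSpace ℝ (Fin 3) => ∫⁻ η, U η * V (ξ - η)) := hUV.lintegral_prod_right'
  apply aux_dual volume (by fun_prop)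
  intro h hh
  set A : EuclideanSpace ℝ (Fin 3) × EuclideanSpace ℝ (Fin 3) → ℝ≥0∞ := fun p => h p.1 * (ENNReal.ofReal ((1 + ‖p.2‖ ^ 2) ^ (s / 2)) * U p.2)
    with hA
  set B : EuclideanSpace ℝ (Fin 3) × EuclideanSpace ℝ (Fin 3) → ℝ≥0∞ := fun p => ENNReal.ofReal (‖p.1‖ ^ (-1 : ℝ)) *
    ENNReal.ofReal ((1 + ‖p.2‖ ^ 2) ^ (-s / 2)) * V (p.1 - p.2) with hB
  have hAm : Measurable A := by fun_prop
  have hBm : Measurable B := by fun_prop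
  have e1 : ∫⁻ a, h a * (ENNReal.ofReal (‖a‖ ^ (-1 : ℝ)) * ∫⁻ η, U η * V (a - η)) =
      ∫⁻ p : EuclideanSpace ℝ (Fin 3) × EuclideanSpace ℝ (Fin 3), A p * B p := by
    rw [Measure.volume_eq_prod, lintegral_prod _ (by fun_prop)]
    congr 1 with ξ
    rw [← mul_assoc, ← lintegral_const_mul _ (by fun_prop)]
    congr 1 with η
    simp only [hA, hB]
    have : ENNReal.ofReal ((1 + ‖η‖ ^ 2) ^ (s / 2)) * ENNReal.ofReal ((1 + ‖η‖ ^ 2) ^ (-s / 2)) = 1 := by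
      rw [← ENNReal.ofReal_mul (by positivity), ← Real.rpow_add (by positivity)]
      have : s / 2 + -s / 2 = 0 := by ring
      simp [this]
    calc _ = h ξ * ENNReal.ofReal (‖ξ‖ ^ (-1 : ℝ)) * (U η * V (ξ - η)) * 1 := by rw [mul_one]
      _ = _ := by rw [← this]; ring
  have eA : ∫⁻ p : EuclideanSpace ℝ (Fin 3) × EuclideanSpace ℝ (Fin 3), A p ^ 2 =
      (∫⁻ a, h a ^ 2) * ∫⁻ ξ, ENNReal.ofReal ((1 + ‖ξ‖ ^ 2) ^ s) * U ξ ^ 2 := by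
    rw [Measure.volume_eq_prod, ← lintegral_prod_mul (by fun_prop) (by fun_prop)]
    congr 1 with p
    simp only [hA]
    rw [mul_pow, mul_pow, ← ENNReal.ofReal_pow (by positivity), ← Real.rpow_natCast,
      ← Real.rpow_mul (by positivity)]
    congr 4; push_cast; ring_nf
  have eB : ∫⁻ p : EuclideanSpace ℝ (Fin 3) × EuclideanSpace ℝ (Fin 3), B p ^ 2 ≤
      D * ∫⁻ ξ, ENNReal.ofReal ((1 + ‖ξ‖ ^ 2) ^ (s - 1)) * V ξ ^ 2 := by
    have eB2 : ∀ p : EuclideanSpace ℝ (Fin 3) × EuclideanSpace ℝ (Fin 3), B p ^ 2 = ENNReal.ofReal (‖p.1‖ ^ (-2 : ℝ)) *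
        ENNReal.ofReal ((1 + ‖p.2‖ ^ 2) ^ (-s)) * V (p.1 - p.2) ^ 2 := fun p => by
      simp only [hB]
      rw [mul_pow, mul_pow, ← ENNReal.ofReal_pow (by positivity),
        ← ENNReal.ofReal_pow (by positivity), ← Real.rpow_natCast, ← Real.rpow_natCast,
        ← Real.rpow_mul (by positivity), ← Real.rpow_mul (by positivity)]
      congr 5
      · norm_num
      · push_cast; ring
    calc ∫⁻ p : EuclideanSpace ℝ (Fin 3) × EuclideanSpace ℝ (Fin 3), B p ^ 2
        = ∫⁻ ξ : EuclideanSpace ℝ (Fin 3), ∫⁻ η : EuclideanSpace ℝ (Fin 3), ENNReal.ofReal (‖ξ‖ ^ (-2 : ℝ)) *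
        ENNReal.ofReal ((1 + ‖η‖ ^ 2) ^ (-s)) * V (ξ - η) ^ 2 := by
          rw [Measure.volume_eq_prod, lintegral_prod _ (by fun_prop)]
          simp only [eB2]
      _ = ∫⁻ ξ : EuclideanSpace ℝ (Fin 3), ∫⁻ ζ : EuclideanSpace ℝ (Fin 3), ENNReal.ofReal (‖ξ‖ ^ (-2 : ℝ)) *
        ENNReal.ofReal ((1 + ‖ξ - ζ‖ ^ 2) ^ (-s)) * V ζ ^ 2 := by
          congr 1 with ξ
          rw [← lintegral_sub_left_eq_self _ ξ]
          simp
      _ = ∫⁻ ζ : EuclideanSpace ℝ (Fin 3), ∫⁻ ξ : EuclideanSpace ℝ (Fin 3), ENNReal.ofReal (‖ξ‖ ^ (-2 : ℝ)) *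
        ENNReal.ofReal ((1 + ‖ξ - ζ‖ ^ 2) ^ (-s)) * V ζ ^ 2 := by
          apply lintegral_lintegral_swap
          apply Measurable.aemeasurable
          unfold Function.uncurry
          fun_prop
      _ ≤ ∫⁻ ζ : EuclideanSpace ℝ (Fin 3), D * (ENNReal.ofReal ((1 + ‖ζ‖ ^ 2) ^ (s - 1)) * V ζ ^ 2) := by
          apply lintegral_mono
          intro ζ
          dsimp only
          rw [lintegral_mul_const _ (by fun_prop), ← mul_assoc]
          gcongr
          exact hD ζ
      _ = _ := lintegral_const_mul _ (by fun_prop)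
  rw [e1]
  refine (aux_CS volume hAm hBm).trans ?_
  rw [eA]
  refine (mul_le_mul_right eB _).trans_eq ?_
  ring

/-- Product estimate `‖uv‖_{Ḣ^{-1}} ≲ ‖u‖_{H^s} ‖v‖_{H^{s-1}}` on `ℝ³` for `3/4 < s ≤ 1`,
stated on the Fourier side: the Fourier transform of the product is the convolution
`uh ⋆ vh`, and the (squared) weighted `L²` norms represent the Sobolev norms. -/
theorem product_Hs_Hsm1_into_homHm1 (s : ℝ) (hs0 : 3 / 4 < s) (hs1 : s ≤ 1) :
    ∃ C : ℝ, 0 < C ∧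
      ∀ uh vh : EuclideanSpace ℝ (Fin 3) → ℂ, Measurable uh → Measurable vh →
        (∫⁻ ξ, ENNReal.ofReal (‖ξ‖ ^ (-2 : ℝ)) *
            (‖∫ η, uh η * vh (ξ - η)‖₊ : ℝ≥0∞) ^ 2) ≤
          ENNReal.ofReal C *
            (∫⁻ ξ, ENNReal.ofReal ((1 + ‖ξ‖ ^ 2) ^ s) * (‖uh ξ‖₊ : ℝ≥0∞) ^ 2) *
            (∫⁻ ξ, ENNReal.ofReal ((1 + ‖ξ‖ ^ 2) ^ (s - 1)) * (‖vh ξ‖₊ : ℝ≥0∞) ^ 2) := by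
  obtain ⟨D, hD, h⟩ := aux_K s hs0 hs1
  refine ⟨D.toReal + 1, by positivity, fun uh vh hu hv => ?_⟩
  have hm := aux_main s h (U := fun x => ‖uh x‖ₑ) (V := fun x => ‖vh x‖ₑ) hu.enorm hv.enorm
  have hDC : D ≤ ENNReal.ofReal (D.toReal + 1) := by
    calc D = ENNReal.ofReal D.toReal := (ENNReal.ofReal_toReal hD).symm
      _ ≤ _ := ENNReal.ofReal_le_ofReal (by linarith)
  simp only [← enorm_eq_nnnorm]
  refine le_trans ?_ (hm.trans (by gcongr))
  apply lintegral_mono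
  intro ξ
  dsimp only
  rw [mul_pow, ← ENNReal.ofReal_pow (by positivity), ← Real.rpow_natCast,
    ← Real.rpow_mul (by positivity)]
  have e : (-1 : ℝ) * ((2 : ℕ) : ℝ) = -2 := by norm_num
  rw [e]
  gcongr
  refine (enorm_integral_le_lintegral_enorm _).trans (le_of_eq ?_)
  simp only [enorm_mul]
end

section
/- Let s, s₁, s₂ be real numbers with s₁ + s₂ ≥ 0, s ≤ min(s₁, s₂), and s < s₁ + s₂ − 3/2. Then for all φ ∈ H^{s₁}(ℝ³) and ψ ∈ H^{s₂}(ℝ³), ‖φψ‖_{H^s} ≤ C ‖φ‖_{H^{s₁}} ‖ψ‖_{H^{s₂}}. -/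
open MeasureTheory
open scoped ENNReal

/-- If `x` is the smallest of the three and `y ~ z`, the product weight is `≲ x ^ (a+b+c)`. -/
lemma weight_core (x y z a b c : ℝ) (hx : 1 ≤ x) (hxy : x ≤ y) (hyz : y ≤ 4 * z)
    (hzy : z ≤ 4 * y) (hz : 1 ≤ z) (hbc : b + c ≤ 0) :
    x ^ a * y ^ b * z ^ c ≤ 4 ^ |c| * x ^ (a + b + c) := by
  have hx0 : 0 < x := by linarith
  have hy0 : 0 < y := by linarith
  have hz0 : 0 < z := by linarith
  have h4 : z ^ c ≤ 4 ^ |c| * y ^ c := by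
    rcases le_total 0 c with hc | hc
    · rw [abs_of_nonneg hc, ← Real.mul_rpow (by norm_num) hy0.le]
      exact Real.rpow_le_rpow hz0.le hzy hc
    · rw [abs_of_nonpos hc]
      have : z ^ c ≤ (y / 4) ^ c :=
        Real.rpow_le_rpow_of_nonpos (by positivity) (by linarith) hc
      rw [Real.div_rpow hy0.le (by norm_num)] at this
      rw [Real.rpow_neg (by norm_num)]
      refine this.trans (le_of_eq ?_)
      rw [div_eq_mul_inv, mul_comm]
  have h5 : y ^ (b + c) ≤ x ^ (b + c) := Real.rpow_le_rpow_of_nonpos hx0 hxy hbc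
  calc x ^ a * y ^ b * z ^ c ≤ x ^ a * y ^ b * (4 ^ |c| * y ^ c) := by gcongr
    _ = 4 ^ |c| * (x ^ a * y ^ (b + c)) := by rw [Real.rpow_add hy0]; ring
    _ ≤ 4 ^ |c| * (x ^ a * x ^ (b + c)) := by gcongr
    _ = 4 ^ |c| * x ^ (a + b + c) := by rw [← Real.rpow_add hx0]; ring_nf

lemma weight_three (x y z a b c : ℝ) (hx : 1 ≤ x) (hy : 1 ≤ y) (hz : 1 ≤ z)
    (h1 : x ≤ 2 * (y + z)) (h2 : y ≤ 2 * (x + z)) (h3 : z ≤ 2 * (x + y))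
    (hab : a + b ≤ 0) (hac : a + c ≤ 0) (hbc : b + c ≤ 0) :
    x ^ a * y ^ b * z ^ c ≤ 4 ^ (|a| + |b| + |c|) *
      (x ^ (a + b + c) + y ^ (a + b + c) + z ^ (a + b + c)) := by
  have hx0 : 0 < x := by linarith
  have hy0 : 0 < y := by linarith
  have hz0 : 0 < z := by linarith
  have px := Real.rpow_pos_of_pos hx0 (a + b + c)
  have py := Real.rpow_pos_of_pos hy0 (a + b + c)
  have pz := Real.rpow_pos_of_pos hz0 (a + b + c)
  have na := abs_nonneg a
  have nb := abs_nonneg b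
  have nc := abs_nonneg c
  have key : (x ≤ y ∧ x ≤ z) ∨ (y ≤ x ∧ y ≤ z) ∨ (z ≤ x ∧ z ≤ y) := by grind
  rcases key with ⟨k1, k2⟩ | ⟨k1, k2⟩ | ⟨k1, k2⟩
  · refine (weight_core x y z a b c hx k1 (by linarith) (by linarith) hz hbc).trans ?_
    gcongr
    · norm_num
    · linarith
    · linarith
  · have := weight_core y x z b a c hy k1 (by linarith) (by linarith) hz hac
    rw [show b + a + c = a + b + c by ring, mul_comm (y ^ b)] at this
    refine this.trans ?_
    gcongr
    · norm_num
    · linarith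
    · linarith
  · have := weight_core z x y c a b hz k1 (by linarith) (by linarith) hy hab
    rw [show c + a + b = a + b + c by ring] at this
    refine (le_of_eq (by ring)).trans (this.trans ?_)
    gcongr
    · norm_num
    · linarith
    · linarith

lemma ennreal_add_sq_le (a b : ℝ≥0∞) : (a + b) ^ 2 ≤ 4 * (a ^ 2 + b ^ 2) := by
  rcases le_total a b with h | h
  · calc (a + b) ^ 2 ≤ (b + b) ^ 2 := by gcongr
      _ = 4 * b ^ 2 := by ring
      _ ≤ _ := by gcongr; exact le_add_self
  · calc (a + b) ^ 2 ≤ (a + a) ^ 2 := by gcongr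
      _ = 4 * a ^ 2 := by ring
      _ ≤ _ := by gcongr; exact le_self_add

lemma lintegral_cs {α : Type*} [MeasurableSpace α] (μ : Measure α) (f g : α → ℝ≥0∞)
    (hf : Measurable f) (hg : Measurable g) :
    (∫⁻ x, f x * g x ∂μ) ^ 2 ≤ (∫⁻ x, f x ^ 2 ∂μ) * ∫⁻ x, g x ^ 2 ∂μ := by
  have h := ENNReal.lintegral_mul_le_Lp_mul_Lq μ Real.HolderConjugate.two_two
    hf.aemeasurable hg.aemeasurable
  simp only [Pi.mul_apply, ENNReal.rpow_two] at h
  calc _ ≤ ((∫⁻ x, f x ^ 2 ∂μ) ^ (1 / 2 : ℝ) * (∫⁻ x, g x ^ 2 ∂μ) ^ (1 / 2 : ℝ)) ^ 2 := by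
        gcongr
    _ = _ := by
        rw [mul_pow, ← ENNReal.rpow_two, ← ENNReal.rpow_two, ← ENNReal.rpow_mul,
          ← ENNReal.rpow_mul]
        norm_num

lemma one_add_norm_sq_le {E : Type*} [NormedAddCommGroup E] (a b c : E)
    (h : ‖a‖ ≤ ‖b‖ + ‖c‖) : 1 + ‖a‖ ^ 2 ≤ 2 * ((1 + ‖b‖ ^ 2) + (1 + ‖c‖ ^ 2)) := by
  nlinarith [norm_nonneg a, norm_nonneg b, norm_nonneg c, sq_nonneg (‖b‖ - ‖c‖)]

/-- The Japanese-bracket weight, as an extended nonnegative function. -/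
noncomputable def wgt (p : ℝ) (ξ : EuclideanSpace ℝ (Fin 3)) : ℝ≥0∞ :=
  ENNReal.ofReal ((1 + ‖ξ‖ ^ 2) ^ p)

lemma measurable_wgt (p : ℝ) : Measurable (wgt p) := by
  unfold wgt
  fun_prop

lemma wgt_sq (p : ℝ) (ξ : EuclideanSpace ℝ (Fin 3)) : wgt p ξ ^ 2 = wgt (2 * p) ξ := by
  unfold wgt
  rw [← ENNReal.ofReal_pow (by positivity), ← Real.rpow_natCast, ← Real.rpow_mul (by positivity)]
  congr 2
  push_cast
  ring

lemma wgt_mul_neg (p : ℝ) (ξ : EuclideanSpace ℝ (Fin 3)) : wgt (-p) ξ * wgt p ξ = 1 := by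
  unfold wgt
  rw [← ENNReal.ofReal_mul (by positivity), ← Real.rpow_add (by positivity)]
  simp

lemma wgt_lintegral (t : ℝ) (ht : 3 / 2 < t) : ∫⁻ ξ, wgt (-t) ξ < ∞ := by
  have h : Integrable (fun ξ : EuclideanSpace ℝ (Fin 3) => (1 + ‖ξ‖ ^ 2) ^ (-(2 * t) / 2)) :=
    integrable_rpow_neg_one_add_norm_sq (by simp; linarith)
  have e : -(2 * t) / 2 = -t := by ring
  rw [e] at h
  exact h.lintegral_lt_top

lemma wgt_three (a b c : ℝ) (hab : a + b ≤ 0) (hac : a + c ≤ 0) (hbc : b + c ≤ 0)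
    (ξ η : EuclideanSpace ℝ (Fin 3)) :
    wgt a ξ * wgt b η * wgt c (ξ - η) ≤ ENNReal.ofReal (4 ^ (|a| + |b| + |c|)) *
      (wgt (a + b + c) ξ + wgt (a + b + c) η + wgt (a + b + c) (ξ - η)) := by
  unfold wgt
  rw [← ENNReal.ofReal_mul (by positivity), ← ENNReal.ofReal_mul (by positivity),
    ← ENNReal.ofReal_add (by positivity) (by positivity),
    ← ENNReal.ofReal_add (by positivity) (by positivity), ← ENNReal.ofReal_mul (by positivity)]
  apply ENNReal.ofReal_le_ofReal
  apply weight_three _ _ _ a b c _ _ _ _ _ _ hab hac hbc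
  · nlinarith [norm_nonneg ξ]
  · nlinarith [norm_nonneg η]
  · nlinarith [norm_nonneg (ξ - η)]
  · apply one_add_norm_sq_le
    simpa using norm_add_le η (ξ - η)
  · apply one_add_norm_sq_le
    simpa using norm_sub_le ξ (ξ - η)
  · apply one_add_norm_sq_le
    exact norm_sub_le ξ η

/-- Convolution-type bound for `L²` functions with an `L²` multiplier in each of the
three positions. -/
lemma trilinear_bound (m F G : EuclideanSpace ℝ (Fin 3) → ℝ≥0∞)
    (hm : Measurable m) (hF : Measurable F) (hG : Measurable G) :
    ∫⁻ ξ, (∫⁻ η, (m ξ + m η + m (ξ - η)) * (F η * G (ξ - η))) ^ 2 ≤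
      36 * ((∫⁻ ξ, m ξ ^ 2) * (∫⁻ ξ, F ξ ^ 2) * (∫⁻ ξ, G ξ ^ 2)) := by
  set M := ∫⁻ ξ, m ξ ^ 2 with hM
  set A := ∫⁻ ξ, F ξ ^ 2 with hA
  set B := ∫⁻ ξ, G ξ ^ 2 with hB
  have hFG : ∀ ξ, Measurable fun η => F η * G (ξ - η) := fun ξ => by fun_prop
  have tr : ∀ (f : EuclideanSpace ℝ (Fin 3) → ℝ≥0∞) ξ,
      ∫⁻ η, f (ξ - η) = ∫⁻ η, f η := fun f ξ => lintegral_sub_left_eq_self f ξ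
  have pt : ∀ ξ, (∫⁻ η, (m ξ + m η + m (ξ - η)) * (F η * G (ξ - η))) ^ 2 ≤
      4 * (m ξ ^ 2 * (A * B)) + 32 * (M * ∫⁻ η, F η ^ 2 * G (ξ - η) ^ 2) := by
    intro ξ
    have e : ∫⁻ η, (m ξ + m η + m (ξ - η)) * (F η * G (ξ - η)) =
        m ξ * (∫⁻ η, F η * G (ξ - η)) + ((∫⁻ η, m η * (F η * G (ξ - η))) +
          ∫⁻ η, m (ξ - η) * (F η * G (ξ - η))) := by
      rw [← lintegral_const_mul _ (hFG ξ),
        ← lintegral_add_left (f := fun η => m η * (F η * G (ξ - η))) (by fun_prop),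
        ← lintegral_add_left (f := fun η => m ξ * (F η * G (ξ - η))) (by fun_prop)]
      congr 1
      ext η
      ring
    have c1 : (∫⁻ η, F η * G (ξ - η)) ^ 2 ≤ A * B := by
      have := lintegral_cs volume F (fun η => G (ξ - η)) hF (by fun_prop)
      rwa [tr (fun η => G η ^ 2)] at this
    have c2 : (∫⁻ η, m η * (F η * G (ξ - η))) ^ 2 ≤ M * ∫⁻ η, F η ^ 2 * G (ξ - η) ^ 2 := by
      have := lintegral_cs volume m (fun η => F η * G (ξ - η)) hm (by fun_prop)
      simpa only [mul_pow] using this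
    have c3 : (∫⁻ η, m (ξ - η) * (F η * G (ξ - η))) ^ 2 ≤
        M * ∫⁻ η, F η ^ 2 * G (ξ - η) ^ 2 := by
      have := lintegral_cs volume (fun η => m (ξ - η)) (fun η => F η * G (ξ - η))
        (by fun_prop) (by fun_prop)
      rw [tr (fun η => m η ^ 2)] at this
      simpa only [mul_pow] using this
    rw [e]
    refine (ennreal_add_sq_le _ _).trans ?_
    calc _ ≤ 4 * ((m ξ * ∫⁻ η, F η * G (ξ - η)) ^ 2 +
          4 * ((∫⁻ η, m η * (F η * G (ξ - η))) ^ 2 +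
            (∫⁻ η, m (ξ - η) * (F η * G (ξ - η))) ^ 2)) := by
          gcongr
          exact ennreal_add_sq_le _ _
      _ ≤ 4 * (m ξ ^ 2 * (A * B) + 4 * (M * (∫⁻ η, F η ^ 2 * G (ξ - η) ^ 2) +
            M * (∫⁻ η, F η ^ 2 * G (ξ - η) ^ 2))) := by
          rw [mul_pow]
          gcongr
      _ = _ := by ring
  have conv : ∫⁻ ξ, ∫⁻ η, F η ^ 2 * G (ξ - η) ^ 2 = A * B := by
    rw [lintegral_lintegral_swap (by fun_prop)]
    have : ∀ η, ∫⁻ ξ, F η ^ 2 * G (ξ - η) ^ 2 = F η ^ 2 * B := by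
      intro η
      rw [lintegral_const_mul _ (by fun_prop),
        lintegral_sub_right_eq_self (fun ξ => G ξ ^ 2) η]
    simp_rw [this]
    rw [lintegral_mul_const _ (by fun_prop)]
  have hmeas : Measurable fun ξ => ∫⁻ η, F η ^ 2 * G (ξ - η) ^ 2 := by
    apply Measurable.lintegral_prod_right'
      (f := fun p : EuclideanSpace ℝ (Fin 3) × EuclideanSpace ℝ (Fin 3) =>
        F p.2 ^ 2 * G (p.1 - p.2) ^ 2)
    fun_prop
  calc _ ≤ ∫⁻ ξ, (4 * (m ξ ^ 2 * (A * B)) + 32 * (M * ∫⁻ η, F η ^ 2 * G (ξ - η) ^ 2)) :=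
        lintegral_mono pt
    _ = 4 * (M * (A * B)) + 32 * (M * (A * B)) := by
        rw [lintegral_add_left (by fun_prop), lintegral_const_mul _ (by fun_prop),
          lintegral_mul_const _ (by fun_prop), lintegral_const_mul _ (by fun_prop),
          lintegral_const_mul _ hmeas, conv]
    _ = _ := by ring

/-- Sobolev multiplication law `‖φψ‖_{H^s} ≲ ‖φ‖_{H^{s₁}} ‖ψ‖_{H^{s₂}}` on `ℝ³`, for
`s₁ + s₂ ≥ 0`, `s ≤ min(s₁,s₂)`, `s < s₁ + s₂ − 3/2`, stated on the Fourier side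
(the product corresponds to the convolution of the Fourier transforms). -/
theorem sobolev_multiplication_law (s s₁ s₂ : ℝ)
    (h12 : 0 ≤ s₁ + s₂) (h1 : s ≤ s₁) (h2 : s ≤ s₂) (h3 : s < s₁ + s₂ - 3 / 2) :
    ∃ C : ℝ, 0 < C ∧
      ∀ uh vh : EuclideanSpace ℝ (Fin 3) → ℂ, Measurable uh → Measurable vh →
        (∫⁻ ξ, ENNReal.ofReal ((1 + ‖ξ‖ ^ 2) ^ s) *
            (‖∫ η, uh η * vh (ξ - η)‖₊ : ℝ≥0∞) ^ 2) ≤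
          ENNReal.ofReal C *
            (∫⁻ ξ, ENNReal.ofReal ((1 + ‖ξ‖ ^ 2) ^ s₁) * (‖uh ξ‖₊ : ℝ≥0∞) ^ 2) *
            (∫⁻ ξ, ENNReal.ofReal ((1 + ‖ξ‖ ^ 2) ^ s₂) * (‖vh ξ‖₊ : ℝ≥0∞) ^ 2) := by
  set r : ℝ := s / 2 + -(s₁ / 2) + -(s₂ / 2) with hr
  set K : ℝ := 4 ^ (|s / 2| + |-(s₁ / 2)| + |-(s₂ / 2)|) with hK
  have hK0 : 0 < K := by positivity
  set M : ℝ≥0∞ := ∫⁻ ξ, wgt r ξ ^ 2 with hM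
  have hMfin : M ≠ ∞ := by
    have := wgt_lintegral (s₁ + s₂ - s) (by linarith)
    rw [hM]
    simp_rw [wgt_sq]
    rw [show 2 * r = -(s₁ + s₂ - s) by rw [hr]; ring]
    exact this.ne
  refine ⟨K ^ 2 * (36 * M.toReal) + 1, by positivity, ?_⟩
  intro uh vh hu hv
  set F : EuclideanSpace ℝ (Fin 3) → ℝ≥0∞ := fun ξ => wgt (s₁ / 2) ξ * ‖uh ξ‖₊ with hF
  set G : EuclideanSpace ℝ (Fin 3) → ℝ≥0∞ := fun ξ => wgt (s₂ / 2) ξ * ‖vh ξ‖₊ with hG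
  have mw := measurable_wgt
  have hFm : Measurable F := (mw _).mul hu.nnnorm.coe_nnreal_ennreal
  have hGm : Measurable G := (mw _).mul hv.nnnorm.coe_nnreal_ennreal
  have eF : ∀ ξ, ENNReal.ofReal ((1 + ‖ξ‖ ^ 2) ^ s₁) * (‖uh ξ‖₊ : ℝ≥0∞) ^ 2 = F ξ ^ 2 := by
    intro ξ
    rw [hF]
    simp only []
    rw [mul_pow, wgt_sq, show 2 * (s₁ / 2) = s₁ by ring]
    rfl
  have eG : ∀ ξ, ENNReal.ofReal ((1 + ‖ξ‖ ^ 2) ^ s₂) * (‖vh ξ‖₊ : ℝ≥0∞) ^ 2 = G ξ ^ 2 := by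
    intro ξ
    rw [hG]
    simp only []
    rw [mul_pow, wgt_sq, show 2 * (s₂ / 2) = s₂ by ring]
    rfl
  simp_rw [eF, eG]
  have pt : ∀ ξ, ENNReal.ofReal ((1 + ‖ξ‖ ^ 2) ^ s) *
      (‖∫ η, uh η * vh (ξ - η)‖₊ : ℝ≥0∞) ^ 2 ≤ ENNReal.ofReal K ^ 2 *
        (∫⁻ η, (wgt r ξ + wgt r η + wgt r (ξ - η)) * (F η * G (ξ - η))) ^ 2 := by
    intro ξ
    have e1 : ENNReal.ofReal ((1 + ‖ξ‖ ^ 2) ^ s) = wgt (s / 2) ξ ^ 2 := by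
      rw [wgt_sq, show 2 * (s / 2) = s by ring]
      rfl
    rw [e1, ← mul_pow, ← mul_pow]
    gcongr ?_ ^ 2
    have hi : (‖∫ η, uh η * vh (ξ - η)‖₊ : ℝ≥0∞) ≤ ∫⁻ η, ‖uh η‖₊ * ‖vh (ξ - η)‖₊ := by
      refine (enorm_integral_le_lintegral_enorm _).trans (le_of_eq ?_)
      congr 1
      ext η
      rw [enorm_mul]
      rfl
    calc _ ≤ wgt (s / 2) ξ * ∫⁻ η, ‖uh η‖₊ * ‖vh (ξ - η)‖₊ := by gcongr
      _ = ∫⁻ η, wgt (s / 2) ξ * (‖uh η‖₊ * ‖vh (ξ - η)‖₊) := by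
          rw [lintegral_const_mul' _ _ (by simp [wgt])]
      _ ≤ ∫⁻ η, ENNReal.ofReal K *
            ((wgt r ξ + wgt r η + wgt r (ξ - η)) * (F η * G (ξ - η))) := by
          refine lintegral_mono fun η => ?_
          have w3 := wgt_three (s / 2) (-(s₁ / 2)) (-(s₂ / 2)) (by linarith) (by linarith)
            (by linarith) ξ η
          calc wgt (s / 2) ξ * (‖uh η‖₊ * ‖vh (ξ - η)‖₊)
              = wgt (s / 2) ξ * ((wgt (-(s₁ / 2)) η * wgt (s₁ / 2) η) * ‖uh η‖₊ *
                ((wgt (-(s₂ / 2)) (ξ - η) * wgt (s₂ / 2) (ξ - η)) * ‖vh (ξ - η)‖₊)) := by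
                rw [wgt_mul_neg, wgt_mul_neg, one_mul, one_mul]
            _ = (wgt (s / 2) ξ * wgt (-(s₁ / 2)) η * wgt (-(s₂ / 2)) (ξ - η)) *
                (F η * G (ξ - η)) := by
                simp only [hF, hG]
                ring
            _ ≤ (ENNReal.ofReal K * (wgt r ξ + wgt r η + wgt r (ξ - η))) *
                (F η * G (ξ - η)) := by gcongr
            _ = _ := by ring
      _ = _ := by rw [lintegral_const_mul' _ _ (by simp)]
  have hC : ENNReal.ofReal K ^ 2 * (36 * M) ≤
      ENNReal.ofReal (K ^ 2 * (36 * M.toReal) + 1) := by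
    calc ENNReal.ofReal K ^ 2 * (36 * M) = ENNReal.ofReal (K ^ 2 * (36 * M.toReal)) := by
          rw [ENNReal.ofReal_mul (by positivity), ENNReal.ofReal_mul (by norm_num),
            ENNReal.ofReal_toReal hMfin, ENNReal.ofReal_pow hK0.le]
          norm_num
      _ ≤ _ := ENNReal.ofReal_le_ofReal (by linarith)
  calc _ ≤ ∫⁻ ξ, ENNReal.ofReal K ^ 2 *
        (∫⁻ η, (wgt r ξ + wgt r η + wgt r (ξ - η)) * (F η * G (ξ - η))) ^ 2 := lintegral_mono pt
    _ = ENNReal.ofReal K ^ 2 * ∫⁻ ξ,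
        (∫⁻ η, (wgt r ξ + wgt r η + wgt r (ξ - η)) * (F η * G (ξ - η))) ^ 2 := by
        rw [lintegral_const_mul' _ _ (by simp)]
    _ ≤ ENNReal.ofReal K ^ 2 * (36 * (M * (∫⁻ ξ, F ξ ^ 2) * (∫⁻ ξ, G ξ ^ 2))) := by
        gcongr
        exact trilinear_bound _ F G (mw r) hFm hGm
    _ = (ENNReal.ofReal K ^ 2 * (36 * M)) * (∫⁻ ξ, F ξ ^ 2) * (∫⁻ ξ, G ξ ^ 2) := by ring
    _ ≤ _ := by gcongr
end
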